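/- Let n, p, m, n_c ∈ ℕ with n_c ≥ 1, let f : ℝⁿ × ℝᵖ → ℝⁿ be the discrete-time closed-loop map, and work in ℝ[x₁,…,x_n, r₁,…,r_p]. Let V be a polynomial in (x,r), c₁,…,c_{n_c} polynomials in (x,r), and c̄₁,…,c̄_{n_c}, Γ̂₁,…,Γ̂_{n_c} polynomials in r only. Suppose: (a) for each i = 1,…,n_c there exist a polynomial q_i and SOS polynomials s_{i,1},…,s_{i,n_c} such that V − Γ̂_i + q_i·c_i − Σ_{j=1}^{n_c} s_{i,j}·c̄_j is a sum of squares; (b) r ∈ ℝᵖ satisfies c̄_j(r) ≥ 0 for all j; (c) with Γ̂(r) := min_i Γ̂_i(r), the strict sublevel set S(r) = {x : V(x,r) < Γ̂(r)} is preconnected and contains a point x̄ with c_i(x̄,r) > 0 for all i; and (d) V(f(x,r),r) ≤ V(x,r) for all x ∈ ℝⁿ. Then for every x₀ ∈ S(r) and every k ∈ ℕ, the iterate x_k defined by x_{k+1} = f(x_k, r) satisfies x_k ∈ S(r) and c_i(x_k, r) > 0 for all i = 1,…,n_c; that is, S(r) is a safe positively invariant set for the closed loop at the constant admissible reference r. 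-/

import Mathlib

open MvPolynomial

/-- A polynomial is a sum of squares if it is a finite sum of squares of polynomials. -/
def IsSOS {σ : Type*} (s : MvPolynomial σ ℝ) : Prop :=
  ∃ (k : ℕ) (p : Fin k → MvPolynomial σ ℝ), s = ∑ i, p i ^ 2

/-- A sum of squares takes only nonnegative values. -/
lemma IsSOS.eval_nonneg {σ : Type*} {s : MvPolynomial σ ℝ} (hs : IsSOS s) (y : σ → ℝ) :
    0 ≤ eval y s := by
  obtain ⟨k, p, rfl⟩ := hs
  simp only [map_sum, map_pow]
  exact Finset.sum_nonneg fun i _ => sq_nonneg _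

/-- A continuous function which is positive somewhere on a preconnected set and vanishes nowhere
on it is positive on the whole set. -/
lemma IsPreconnected.pos_of_ne_zero {X : Type*} [TopologicalSpace X] {S : Set X}
    (hS : IsPreconnected S) {g : X → ℝ} (hg : ContinuousOn g S) (hne : ∀ z ∈ S, g z ≠ 0)
    {a : X} (ha : a ∈ S) (hga : 0 < g a) {x : X} (hx : x ∈ S) : 0 < g x := by
  by_contra! hle
  obtain ⟨z, hz, hgz⟩ := hS.intermediate_value hx ha hg ⟨hle, hga.le⟩
  exact hne z hz hgz

/-- On the zero set of the constraint `c`, an SOS certificate bounds `V` from below by `Γ` at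
every admissible reference. -/
lemma eval_le_of_isSOS_certificate {α β ι : Type*} [Fintype ι]
    {V q c : MvPolynomial (α ⊕ β) ℝ} {Γ : MvPolynomial β ℝ}
    {s : ι → MvPolynomial (α ⊕ β) ℝ} {cbar : ι → MvPolynomial β ℝ}
    (hs : ∀ j, IsSOS (s j))
    (hcert : IsSOS (V - rename Sum.inr Γ + q * c - ∑ j, s j * rename Sum.inr (cbar j)))
    {x : α → ℝ} {r : β → ℝ} (hr : ∀ j, 0 ≤ eval r (cbar j))
    (hc : eval (Sum.elim x r) c = 0) : eval r Γ ≤ eval (Sum.elim x r) V := by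
  have h := hcert.eval_nonneg (Sum.elim x r)
  simp only [map_sub, map_add, map_mul, map_sum, eval_rename, Sum.elim_comp_inr, hc,
    mul_zero, add_zero] at h
  have hsum : 0 ≤ ∑ j, eval (Sum.elim x r) (s j) * eval r (cbar j) :=
    Finset.sum_nonneg fun j _ => mul_nonneg ((hs j).eval_nonneg _) (hr j)
  linarith

/-- **Safe reference dependent positively invariant sets from SOS certificates
(multi-constraint, discrete time).** Suppose (a) for every constraint `i` there are a
polynomial multiplier `q i` and SOS multipliers `s i j` such that
`V - Γ̂ᵢ + qᵢ·cᵢ - Σⱼ s i j · c̄ⱼ` is a sum of squares; (b) the reference `r` is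
admissible (`c̄ⱼ(r) ≥ 0` for all `j`); (c) with `Γ̂(r) = minᵢ Γ̂ᵢ(r)`, the strict sublevel
set `S(r) = {x : V(x,r) < Γ̂(r)}` is preconnected and contains a point `xbar` with
`cᵢ(xbar,r) > 0` for all `i`; and (d) `V` does not increase along the closed loop
`x ↦ f x r`. Then every trajectory starting in `S(r)` remains in `S(r)` and strictly
satisfies all constraints for all future times: `S(r)` is a safe positively invariant
set. -/
theorem sos_safe_reference_dependent_invariant_set
    (n p n_c : ℕ) (hnc : 1 ≤ n_c)
    (f : (Fin n → ℝ) → (Fin p → ℝ) → (Fin n → ℝ))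
    (V : MvPolynomial (Fin n ⊕ Fin p) ℝ)
    (c : Fin n_c → MvPolynomial (Fin n ⊕ Fin p) ℝ)
    (cbar : Fin n_c → MvPolynomial (Fin p) ℝ)
    (Γhat : Fin n_c → MvPolynomial (Fin p) ℝ)
    (hcert : ∀ i : Fin n_c, ∃ (q : MvPolynomial (Fin n ⊕ Fin p) ℝ)
      (s : Fin n_c → MvPolynomial (Fin n ⊕ Fin p) ℝ),
        (∀ j, IsSOS (s j)) ∧
        IsSOS (V - rename Sum.inr (Γhat i) + q * c i -
          ∑ j, s j * rename Sum.inr (cbar j)))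
    (r : Fin p → ℝ) (hr : ∀ j, 0 ≤ eval r (cbar j))
    (hconn : IsPreconnected
      {x : Fin n → ℝ | eval (Sum.elim x r) V < ⨅ i : Fin n_c, eval r (Γhat i)})
    (xbar : Fin n → ℝ)
    (hxbarS : eval (Sum.elim xbar r) V < ⨅ i : Fin n_c, eval r (Γhat i))
    (hcxbar : ∀ i : Fin n_c, 0 < eval (Sum.elim xbar r) (c i))
    (hdec : ∀ x : Fin n → ℝ, eval (Sum.elim (f x r) r) V ≤ eval (Sum.elim x r) V) :
    ∀ x₀ : Fin n → ℝ,
      eval (Sum.elim x₀ r) V < ⨅ i : Fin n_c, eval r (Γhat i) →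
      ∀ k : ℕ,
        (eval (Sum.elim ((fun x => f x r)^[k] x₀) r) V <
            ⨅ i : Fin n_c, eval r (Γhat i)) ∧
          ∀ i : Fin n_c, 0 < eval (Sum.elim ((fun x => f x r)^[k] x₀) r) (c i) := by
  intro x₀ hx₀ k
  have hinv : eval (Sum.elim ((fun x => f x r)^[k] x₀) r) V < ⨅ i : Fin n_c, eval r (Γhat i) := by
    induction k with
    | zero => exact hx₀
    | succ k ih =>
      rw [Function.iterate_succ_apply']
      exact (hdec _).trans_lt ih
  refine ⟨hinv, fun i => ?_⟩
  have hcont : Continuous fun x : Fin n → ℝ => eval (Sum.elim x r) (c i) := by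
    refine (MvPolynomial.continuous_eval (c i)).comp (continuous_pi ?_)
    rintro (j | j)
    · exact continuous_apply j
    · exact continuous_const
  refine hconn.pos_of_ne_zero hcont.continuousOn (fun z hz hcz => ?_) hxbarS (hcxbar i) hinv
  obtain ⟨q, s, hs, hcert⟩ := hcert i
  have hle : ⨅ i : Fin n_c, eval r (Γhat i) ≤ eval r (Γhat i) :=
    ciInf_le (Set.finite_range _).bddBelow i
  exact (hz.trans_le hle).not_ge (eval_le_of_isSOS_certificate hs hcert hr hcz)
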